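/- For every δ > 0 and d ≥ 1, the wall function W_δ is 1-Lipschitz on ℝ^d: for all x, y ∈ ℝ^d, ‖W_δ(x) − W_δ(y)‖ ≤ ‖x − y‖. -/

import Mathlib

open Real

/-- The wall function `W_δ` on `ℝ^d`. -/
noncomputable def wallFun (δ : ℝ) {d : ℕ} (x : EuclideanSpace ℝ (Fin d)) :
    EuclideanSpace ℝ (Fin d) :=
  if ‖x‖ ≤ 3 * δ / 2 then x
  else (2 * δ - δ / 2 * Real.exp (3 - (2 / δ) * ‖x‖)) • (‖x‖⁻¹ • x)

/-- The radial profile of the wall function. -/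
noncomputable def wallProfile (δ s : ℝ) : ℝ :=
  if s ≤ 3 * δ / 2 then s else 2 * δ - δ / 2 * Real.exp (3 - (2 / δ) * s)

theorem wallProfile_nonneg {δ s : ℝ} (hδ : 0 < δ) (hs : 0 ≤ s) : 0 ≤ wallProfile δ s := by
  unfold wallProfile
  split_ifs with h
  · exact hs
  · have hu : 3 - (2 / δ) * s ≤ 0 := by
      have : δ * (3 - (2 / δ) * s) = 3 * δ - 2 * s := by field_simp
      by_contra! hpos
      nlinarith [mul_pos hδ hpos]
    nlinarith [Real.exp_le_one_iff.2 hu]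

theorem wallProfile_le_self {δ s : ℝ} (hδ : 0 < δ) : wallProfile δ s ≤ s := by
  unfold wallProfile
  split_ifs with h
  · exact le_rfl
  · have he : δ * (3 - (2 / δ) * s) = 3 * δ - 2 * s := by field_simp
    nlinarith [mul_le_mul_of_nonneg_left (Real.add_one_le_exp (3 - (2 / δ) * s)) hδ.le]

theorem Real.exp_sub_exp_le_sub {u v : ℝ} (hvu : v ≤ u) (hu : u ≤ 0) :
    Real.exp u - Real.exp v ≤ u - v := by
  have h : Real.exp v = Real.exp u * Real.exp (v - u) := by rw [← Real.exp_add]; ring_nf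
  have h1 := mul_le_mul_of_nonneg_left (Real.add_one_le_exp (v - u)) (Real.exp_pos u).le
  nlinarith [Real.exp_le_one_iff.2 hu]

theorem wallProfile_sub_bounds {δ s t : ℝ} (hδ : 0 < δ) (hst : s ≤ t) :
    0 ≤ wallProfile δ t - wallProfile δ s ∧ wallProfile δ t - wallProfile δ s ≤ t - s := by
  have exponent (r : ℝ) : δ * (3 - (2 / δ) * r) = 3 * δ - 2 * r := by field_simp
  have exponent_nonpos {r : ℝ} (hr : ¬ r ≤ 3 * δ / 2) : 3 - (2 / δ) * r ≤ 0 := by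
    by_contra! hpos
    nlinarith [mul_pos hδ hpos, exponent r]
  by_cases hs : s ≤ 3 * δ / 2
  · have hs' : wallProfile δ s = s := if_pos hs
    refine ⟨?_, by linarith [wallProfile_le_self (s := t) hδ]⟩
    rw [hs']
    unfold wallProfile
    split_ifs with ht
    · linarith
    · nlinarith [Real.exp_le_one_iff.2 (exponent_nonpos ht)]
  · have ht : ¬ t ≤ 3 * δ / 2 := fun h => hs (hst.trans h)
    have hvu : 3 - (2 / δ) * t ≤ 3 - (2 / δ) * s := by gcongr
    have h1 := mul_le_mul_of_nonneg_left (Real.exp_le_exp.2 hvu) hδ.le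
    have h2 := mul_le_mul_of_nonneg_left
      (Real.exp_sub_exp_le_sub hvu (exponent_nonpos hs)) hδ.le
    have es := exponent s
    have et := exponent t
    simp only [wallProfile, if_neg hs, if_neg ht]
    constructor <;> linarith

theorem abs_wallProfile_sub_le {δ : ℝ} (hδ : 0 < δ) (s t : ℝ) :
    |wallProfile δ s - wallProfile δ t| ≤ |s - t| := by
  rcases le_total s t with h | h
  · obtain ⟨h0, h1⟩ := wallProfile_sub_bounds hδ h
    rw [abs_sub_comm, abs_sub_comm s, abs_of_nonneg h0, abs_of_nonneg (sub_nonneg.2 h)]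
    exact h1
  · obtain ⟨h0, h1⟩ := wallProfile_sub_bounds hδ h
    rw [abs_of_nonneg h0, abs_of_nonneg (sub_nonneg.2 h)]
    exact h1

theorem exists_wallFun_eq_smul {δ : ℝ} (hδ : 0 < δ) {d : ℕ} (x : EuclideanSpace ℝ (Fin d)) :
    ∃ c : ℝ, 0 ≤ c ∧ c ≤ 1 ∧ wallFun δ x = c • x ∧ c * ‖x‖ = wallProfile δ ‖x‖ := by
  by_cases h : ‖x‖ ≤ 3 * δ / 2
  · exact ⟨1, zero_le_one, le_rfl, by simp [wallFun, h], by simp [wallProfile, h]⟩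
  · have hx : 0 < ‖x‖ := by linarith
    refine ⟨wallProfile δ ‖x‖ / ‖x‖, div_nonneg (wallProfile_nonneg hδ hx.le) hx.le,
      (div_le_one hx).2 (wallProfile_le_self hδ), ?_, div_mul_cancel₀ _ hx.ne'⟩
    rw [wallFun, wallProfile, if_neg h, if_neg h, smul_smul, ← div_eq_mul_inv]

/-- Shrinking two vectors does not increase their distance if it does not increase the
difference of their norms. -/
theorem norm_smul_sub_smul_le {E : Type*} [NormedAddCommGroup E] [InnerProductSpace ℝ E]
    {x y : E} {a b : ℝ} (ha0 : 0 ≤ a) (ha1 : a ≤ 1) (hb0 : 0 ≤ b) (hb1 : b ≤ 1)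
    (h : |a * ‖x‖ - b * ‖y‖| ≤ |‖x‖ - ‖y‖|) : ‖a • x - b • y‖ ≤ ‖x - y‖ := by
  refine (sq_le_sq₀ (norm_nonneg _) (norm_nonneg _)).1 ?_
  rw [norm_sub_sq_real, norm_sub_sq_real, norm_smul, norm_smul, real_inner_smul_left,
    real_inner_smul_right, Real.norm_of_nonneg ha0, Real.norm_of_nonneg hb0]
  have hab : a * b ≤ 1 := mul_le_one₀ ha1 hb0 hb1
  have hinner := mul_nonneg (sub_nonneg.2 hab) (sub_nonneg.2 (real_inner_le_norm x y))
  linarith [sq_le_sq.2 h]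

/-- For every `δ > 0` and `d ≥ 1`, the wall function is `1`-Lipschitz on `ℝ^d`:
`‖W_δ(x) − W_δ(y)‖ ≤ ‖x − y‖` for all `x, y`. -/
theorem wallFun_lipschitz (δ : ℝ) (hδ : 0 < δ) (d : ℕ) (hd : 1 ≤ d) :
    ∀ x y : EuclideanSpace ℝ (Fin d), ‖wallFun δ x - wallFun δ y‖ ≤ ‖x - y‖ := by
  intro x y
  obtain ⟨a, ha0, ha1, hx, hax⟩ := exists_wallFun_eq_smul hδ x
  obtain ⟨b, hb0, hb1, hy, hby⟩ := exists_wallFun_eq_smul hδ y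
  rw [hx, hy]
  refine norm_smul_sub_smul_le ha0 ha1 hb0 hb1 ?_
  rw [hax, hby]
  exact abs_wallProfile_sub_le hδ _ _
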